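/- Fix integers N ≥ 1 and n ≥ 0, a real number p ∈ [0,1], and nonnegative reals u_0, u_1, u_2 with u_0 + u_1 + u_2 = 1 and u_1 + u_2 > 0. Let K be a Binomial(N, u_2 + u_0·p) random variable. Independently, let C_n be the number of distinct values among n i.i.d. uniform random variables on {1,...,N}, and, conditionally on C_n, let F be Binomial(C_n, u_1 + u_2). Then E[(K/N)^n] = E[ (u_2/(u_1+u_2))^F · p^{C_n − F} ], with the convention 0^0 = 1. -/

import Mathlib

open Finset

lemma aux_superset (N : ℕ) (q : ℝ) (T : Finset (Fin N)) :
    ∑ S : Finset (Fin N), (if T ⊆ S then q ^ S.card * (1 - q) ^ (N - S.card) else 0)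
      = q ^ T.card := by
  have h := Finset.prod_add (fun _ : Fin N => q) (fun i => if i ∈ T then 0 else 1 - q) Finset.univ
  have h1 : ∏ i : Fin N, (q + if i ∈ T then 0 else 1 - q) = q ^ T.card := by
    have : ∀ i : Fin N, (q + if i ∈ T then 0 else 1 - q) = if i ∈ T then q else 1 := by
      intro i; split_ifs <;> ring
    simp only [this]
    rw [Finset.prod_ite_mem]
    simp
  rw [h1] at h
  rw [h, Finset.powerset_univ]
  refine Finset.sum_congr rfl fun S _ => ?_
  split_ifs with hT
  · rw [Finset.prod_const]
    congr 1
    rw [Finset.prod_congr rfl (g := fun _ => 1 - q), Finset.prod_const]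
    · rw [Finset.card_sdiff_of_subset (Finset.subset_univ S)]; simp
    · intro i hi
      have hi' : i ∉ S := by simpa using hi
      rw [if_neg fun h => hi' (hT h)]
  · obtain ⟨i, hiT, hiS⟩ := Finset.not_subset.1 hT
    rw [Finset.prod_eq_zero (i := i) (s := Finset.univ \ S) (by simpa using hiS) (by simp [hiT])]
    simp

lemma aux_count (N n : ℕ) (S : Finset (Fin N)) :
    ∑ u : Fin n → Fin N, (if Finset.image u Finset.univ ⊆ S then (1 : ℝ) else 0)
      = (S.card : ℝ) ^ n := by
  have : (Finset.univ.filter fun u : Fin n → Fin N => Finset.image u Finset.univ ⊆ S)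
      = Fintype.piFinset fun _ => S := by
    ext u; simp [Finset.image_subset_iff]
  rw [Finset.sum_boole, this]
  simp

lemma aux_main (N n : ℕ) (q : ℝ) :
    ∑ k ∈ Finset.range (N + 1), (N.choose k : ℝ) * q ^ k * (1 - q) ^ (N - k) * (k : ℝ) ^ n
      = ∑ u : Fin n → Fin N, q ^ (Finset.image u Finset.univ).card := by
  have h := Finset.sum_powerset_apply_card (x := (Finset.univ : Finset (Fin N)))
    (fun k => q ^ k * (1 - q) ^ (N - k) * (k : ℝ) ^ n)
  simp only [Finset.card_univ, Fintype.card_fin, nsmul_eq_mul, Finset.powerset_univ] at h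
  simp only [mul_assoc] at h ⊢
  rw [← h]
  calc _ = ∑ S : Finset (Fin N), ∑ u : Fin n → Fin N, q ^ S.card * ((1 - q) ^ (N - S.card) *
          (if Finset.image u Finset.univ ⊆ S then (1 : ℝ) else 0)) := by
        refine Finset.sum_congr rfl fun S _ => ?_
        rw [← aux_count, Finset.mul_sum, Finset.mul_sum]
    _ = _ := by
        rw [Finset.sum_comm]
        refine Finset.sum_congr rfl fun u _ => ?_
        rw [← aux_superset]
        refine Finset.sum_congr rfl fun S _ => ?_
        split_ifs <;> simp

/-- Fix `N ≥ 1`, `n ≥ 0`, `p ∈ [0,1]`, and nonnegative `u_0,u_1,u_2`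
with `u_0+u_1+u_2 = 1` and `u_1+u_2 > 0`. Let `K ~ Binomial(N, u_2 + u_0·p)`;
independently let `C_n` be the number of distinct values among `n` i.i.d. uniforms on
`{1,...,N}` and, given `C_n`, let `F ~ Binomial(C_n, u_1+u_2)`. Then
`E[(K/N)^n] = E[(u_2/(u_1+u_2))^F · p^{C_n−F}]` (convention `0^0 = 1`).
Expectations are written out explicitly: `C_n = |image u|` for `u : Fin n → Fin N`
ranging uniformly over all `N^n` functions. -/
theorem binomial_moment_eq_distinct_count_dual_mutation
    (N n : ℕ) (hN : 1 ≤ N) (p : ℝ) (hp0 : 0 ≤ p) (hp1 : p ≤ 1)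
    (u0 u1 u2 : ℝ) (hu0 : 0 ≤ u0) (hu1 : 0 ≤ u1) (hu2 : 0 ≤ u2)
    (husum : u0 + u1 + u2 = 1) (hupos : 0 < u1 + u2) :
    ∑ k ∈ Finset.range (N + 1),
        (N.choose k : ℝ) * (u2 + u0 * p) ^ k * (1 - (u2 + u0 * p)) ^ (N - k) *
          ((k : ℝ) / N) ^ n
      = (1 / (N : ℝ) ^ n) *
          ∑ u : Fin n → Fin N,
            ∑ f ∈ Finset.range ((Finset.image u Finset.univ).card + 1),
              ((Finset.image u Finset.univ).card.choose f : ℝ) * (u1 + u2) ^ f *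
                u0 ^ ((Finset.image u Finset.univ).card - f) *
                ((u2 / (u1 + u2)) ^ f * p ^ ((Finset.image u Finset.univ).card - f)) := by
  have hne : u1 + u2 ≠ 0 := hupos.ne'
  have hin : ∀ c : ℕ, ∑ f ∈ Finset.range (c + 1), (c.choose f : ℝ) * (u1 + u2) ^ f *
      u0 ^ (c - f) * ((u2 / (u1 + u2)) ^ f * p ^ (c - f)) = (u2 + u0 * p) ^ c := by
    intro c
    rw [add_pow]
    refine Finset.sum_congr rfl fun f _ => ?_
    rw [div_pow, mul_pow]
    field_simp
  simp only [hin]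
  rw [← aux_main, Finset.mul_sum]
  refine Finset.sum_congr rfl fun k _ => ?_
  rw [div_pow]
  ring
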